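/- Let G be a group admitting a bi-invariant circular ordering. Then G × G is circularly-orderable if and only if G is left-orderable. -/

import Mathlib

/-- A (left-invariant, homogeneous) circular ordering on a group `G`. -/
def IsHomCircularOrdering {G : Type*} [Group G] (c : G → G → G → ℤ) : Prop :=
  (∀ g₁ g₂ g₃ : G, c g₁ g₂ g₃ = 0 ∨ c g₁ g₂ g₃ = 1 ∨ c g₁ g₂ g₃ = -1) ∧
  (∀ g₁ g₂ g₃ : G, c g₁ g₂ g₃ = 0 ↔ (g₁ = g₂ ∨ g₁ = g₃ ∨ g₂ = g₃)) ∧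
  (∀ g₁ g₂ g₃ g₄ : G, c g₂ g₃ g₄ - c g₁ g₃ g₄ + c g₁ g₂ g₄ - c g₁ g₂ g₃ = 0) ∧
  (∀ h g₁ g₂ g₃ : G, c (h * g₁) (h * g₂) (h * g₃) = c g₁ g₂ g₃)

/-- A bi-invariant circular ordering: a circular ordering also invariant under
right multiplication. -/
def IsBiInvariantCircularOrdering {G : Type*} [Group G] (c : G → G → G → ℤ) : Prop :=
  IsHomCircularOrdering c ∧ ∀ h g₁ g₂ g₃ : G, c (g₁ * h) (g₂ * h) (g₃ * h) = c g₁ g₂ g₃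

/-- A group is circularly-orderable if it admits a (left-invariant) circular ordering. -/
def CircularlyOrderable (G : Type*) [Group G] : Prop :=
  ∃ c : G → G → G → ℤ, IsHomCircularOrdering c

/-- The obstruction spectrum `Ob(G)` of a group `G`. -/
def Ob (G : Type*) [Group G] : Set ℕ :=
  {n : ℕ | 2 ≤ n ∧ ¬ CircularlyOrderable (G × Multiplicative (ZMod n))}

/-- The set of minimal elements of `Ob(G)` under the divisibility order. -/
def minOb (G : Type*) [Group G] : Set ℕ :=
  {n ∈ Ob G | ∀ m ∈ Ob G, m ∣ n → m = n}

/-- A group is left-orderable if it admits a strict total order invariant under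
left multiplication. -/
def LeftOrderable (G : Type*) [Group G] : Prop :=
  ∃ r : G → G → Prop, IsStrictTotalOrder G r ∧ ∀ a b c : G, r b c → r (a * b) (a * c)

section LeftOrders

variable {G : Type*} [Group G]

lemma LeftOrderable.prod {K : Type*} [Group K] (hG : LeftOrderable G) (hK : LeftOrderable K) :
    LeftOrderable (G × K) := by
  obtain ⟨r, hr, hr_mul⟩ := hG
  obtain ⟨s, hs, hs_mul⟩ := hK
  refine ⟨Prod.Lex r s, { toTrichotomous := inferInstance, toIsStrictOrder := { } }, ?_⟩
  rintro ⟨a, a'⟩ ⟨b, b'⟩ ⟨d, d'⟩ h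
  rw [Prod.lex_def] at h ⊢
  exact h.imp (hr_mul a b d) fun ⟨h₁, h₂⟩ ↦ ⟨congrArg (a * ·) h₁, hs_mul a' b' d' h₂⟩

open Classical in
lemma LeftOrderable.circularlyOrderable (hG : LeftOrderable G) : CircularlyOrderable G := by
  obtain ⟨r, hr, hr_mul⟩ := hG
  have hr_iff (a b d : G) : r (a * b) (a * d) ↔ r b d :=
    ⟨fun h ↦ by simpa using hr_mul a⁻¹ _ _ h, hr_mul a b d⟩
  have irr (a : G) : ¬ r a a := irrefl a
  have tri (a b : G) : r a b ∨ a = b ∨ r b a := trichotomous_of r a b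
  have tr (a b d : G) : r a b → r b d → r a d := _root_.trans
  let s (a b : G) : ℤ := if r a b then 1 else if r b a then -1 else 0
  have hs (a b : G) : (r a b ∧ s a b = 1) ∨ (a = b ∧ s a b = 0) ∨ (r b a ∧ s a b = -1) := by
    grind
  refine ⟨fun a b d ↦ s a b + s b d - s a d, fun a b d ↦ ?_, fun a b d ↦ ?_,
    fun _ _ _ _ ↦ by ring, fun h a b d ↦ by simp only [s, hr_iff]⟩
  all_goals
    have := hs a b
    have := hs b d
    have := hs a d
    clear_value s
    grind

/-- A subsemigroup `P` of `G` not containing `1` such that every `g ≠ 1` is in `P ∪ P⁻¹`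
is the set of positive elements of a left order. -/
lemma leftOrderable_of_positiveCone (P : G → Prop) (h_one : ¬ P 1)
    (h_mul : ∀ a b, P a → P b → P (a * b)) (h_total : ∀ a, a ≠ 1 → P a ∨ P a⁻¹) :
    LeftOrderable G := by
  refine ⟨fun a b ↦ P (a⁻¹ * b),
    { trichotomous := ?_, irrefl := fun a ↦ by simpa, trans := ?_ },
    fun a b d h ↦ by simpa [mul_assoc] using h⟩
  · intro a b h₁ h₂
    by_contra hab
    have := h_total (a⁻¹ * b) (by rwa [ne_eq, inv_mul_eq_one])
    rw [mul_inv_rev, inv_inv] at this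
    tauto
  · intro a b d h₁ h₂
    simpa [mul_assoc] using h_mul _ _ h₁ h₂

end LeftOrders

namespace IsHomCircularOrdering

variable {G : Type*} [Group G] {c : G → G → G → ℤ}

lemma comap {K : Type*} [Group K] (hc : IsHomCircularOrdering c) (f : K →* G)
    (hf : Function.Injective f) : IsHomCircularOrdering fun a b d ↦ c (f a) (f b) (f d) := by
  obtain ⟨h_val, h_zero, h_cocycle, h_mul⟩ := hc
  refine ⟨fun _ _ _ ↦ h_val _ _ _, fun a b d ↦ ?_, fun _ _ _ _ ↦ h_cocycle _ _ _ _,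
    fun h a b d ↦ ?_⟩
  · simp only [h_zero, hf.eq_iff]
  · simp only [map_mul, h_mul]

lemma rotate (hc : IsHomCircularOrdering c) (a b d : G) : c b d a = c a b d := by
  have := hc.2.2.1 a b d a
  have := (hc.2.1 a d a).2 (by simp)
  have := (hc.2.1 a b a).2 (by simp)
  lia

lemma swap (hc : IsHomCircularOrdering c) (a b d : G) : c b a d = -c a b d := by
  have := hc.2.2.1 a b a d
  have := (hc.2.1 a a d).2 (by simp)
  have := (hc.2.1 a b a).2 (by simp)
  lia

lemma trans (hc : IsHomCircularOrdering c) {p a b d : G} (h₁ : c p a b = 1) (h₂ : c p b d = 1) :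
    c p a d = 1 := by
  have := hc.2.2.1 p a b d
  have := hc.1 p a d
  have := hc.1 a b d
  lia

lemma eq_one_or_eq_neg_one (hc : IsHomCircularOrdering c) {a b d : G} (hab : a ≠ b) (had : a ≠ d)
    (hbd : b ≠ d) : c a b d = 1 ∨ c a b d = -1 := by
  have := hc.1 a b d
  have := hc.2.1 a b d
  tauto

/-- Every nonempty finite set of nontrivial elements has a first element after `1`. -/
lemma exists_first (hc : IsHomCircularOrdering c) {s : Set G} (hs : s.Finite) (hne : s.Nonempty)
    (h_one : 1 ∉ s) : ∃ a ∈ s, ∀ b ∈ s, b ≠ a → c 1 a b = 1 := by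
  induction s, hs using Set.Finite.induction_on with
  | empty => exact absurd hne (by simp)
  | @insert x s hx hs ih =>
    rw [Set.mem_insert_iff, not_or] at h_one
    rcases s.eq_empty_or_nonempty with rfl | hne'
    · exact ⟨x, by simp, by simp⟩
    obtain ⟨a, ha, hmin⟩ := ih hne' h_one.2
    have hax : a ≠ x := fun h ↦ hx (h ▸ ha)
    have ha_one : 1 ≠ a := fun h ↦ h_one.2 (h ▸ ha)
    rcases hc.eq_one_or_eq_neg_one ha_one h_one.1 hax with h | h
    · refine ⟨a, Or.inr ha, ?_⟩
      rintro b (rfl | hb) hba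
      exacts [h, hmin b hb hba]
    · have hxa : c 1 x a = 1 := by
        have := hc.swap x 1 a
        have := hc.rotate x a 1
        have := hc.rotate a 1 x
        have := hc.swap a 1 x
        have := hc.rotate 1 x a
        have := hc.rotate 1 a x
        lia
      refine ⟨x, Or.inl rfl, ?_⟩
      rintro b (rfl | hb) hbx
      · exact absurd rfl hbx
      · by_cases hba : b = a
        · exact hba ▸ hxa
        · exact hc.trans hxa (hmin b hb hba)

/-- The first nontrivial element generates: an element `h` first among those outside the
subgroup it generates would be preceded by `t * h`. -/
lemma isCyclic [Finite G] (hc : IsHomCircularOrdering c) : IsCyclic G := by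
  by_cases hG : ∃ x : G, x ≠ 1
  swap
  · push Not at hG
    exact ⟨1, fun x ↦ ⟨1, by simp [hG x]⟩⟩
  obtain ⟨t, ht, ht_min⟩ := hc.exists_first (s := {x | x ≠ 1}) (Set.toFinite _) hG (by simp)
  refine ⟨t, fun x ↦ by_contra fun hx ↦ ?_⟩
  obtain ⟨h, hh, hh_min⟩ := hc.exists_first (s := {x | x ∉ Subgroup.zpowers t}) (Set.toFinite _)
    ⟨x, hx⟩ (by simp [one_mem])
  simp only [Set.mem_ofPred_eq] at *
  have ht_mem := Subgroup.mem_zpowers t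
  have h_one : h ≠ 1 := fun h ↦ hh (h ▸ one_mem _)
  have hth : c 1 t h = 1 := ht_min h h_one fun h ↦ hh (h ▸ ht_mem)
  have h₁ : c 1 h (t⁻¹ * h) = 1 := hh_min _
    (by rwa [Subgroup.mul_mem_cancel_left _ (inv_mem ht_mem)]) (by simpa using ht)
  have h₂ : c 1 h (t * h) = 1 := hh_min _
    (by rwa [Subgroup.mul_mem_cancel_left _ ht_mem]) (by simpa using ht)
  have h₃ := hc.2.2.2 t 1 h (t⁻¹ * h)
  rw [mul_one, mul_inv_cancel_left, h₁] at h₃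
  have := hc.2.2.1 1 t h (t * h)
  have := hc.trans hth h₂
  have := hc.swap h t (t * h)
  have := hc.rotate h t (t * h)
  have := hc.rotate t (t * h) h
  lia

end IsHomCircularOrdering

lemma eq_one_of_pow_eq_one_of_circularlyOrderable_prod {G : Type*} [Group G]
    (h : CircularlyOrderable (G × G)) {x : G} {n : ℕ} (hn : 0 < n) (hx : x ^ n = 1) : x = 1 := by
  obtain ⟨c, hc⟩ := h
  have : Finite (Subgroup.zpowers x) :=
    (isOfFinOrder_iff_pow_eq_one.2 ⟨n, hn, hx⟩).finite_zpowers
  have h_cyc := (hc.comap ((Subgroup.zpowers x).subtype.prodMap (Subgroup.zpowers x).subtype)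
    (Function.Injective.prodMap Subtype.val_injective Subtype.val_injective)).isCyclic
  have h_cop := (Group.isCyclic_prod_iff.1 h_cyc).2.2
  rwa [Nat.coprime_self, Nat.card_zpowers, orderOf_eq_one_iff] at h_cop

section BiorderedGroups

variable {H : Type*} [Group H] [LinearOrder H] [MulLeftMono H] {z : H}

lemma zpow_le_zpow_iff_of_one_lt (hz : 1 < z) {i j : ℤ} : z ^ i ≤ z ^ j ↔ i ≤ j := by
  refine StrictMono.le_iff_le (f := fun i : ℤ ↦ z ^ i) fun i j hij ↦ ?_
  obtain ⟨n, hn, rfl⟩ : ∃ n : ℕ, n ≠ 0 ∧ j = i + n := ⟨(j - i).toNat, by lia, by lia⟩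
  simpa [zpow_add] using one_lt_pow' hz hn

lemma zpow_lt_zpow_iff_of_one_lt (hz : 1 < z) {i j : ℤ} : z ^ i < z ^ j ↔ i < j := by
  rw [← not_le, zpow_le_zpow_iff_of_one_lt hz, not_le]

variable [MulRightMono H]

lemma pow_mul_pow_le_mul_pow {x y : H} (h : x * y ≤ y * x) (n : ℕ) :
    x ^ n * y ^ n ≤ (x * y) ^ n := by
  induction n with
  | zero => simp
  | succ n ih =>
    calc x ^ (n + 1) * y ^ (n + 1) = x * (x ^ n * y ^ n) * y := by
          rw [pow_succ' x, pow_succ y]; group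
      _ ≤ x * (y * x) ^ n * y := by
          gcongr
          exact ih.trans (pow_le_pow_left' h n)
      _ = (x * y) ^ (n + 1) := by rw [mul_assoc, mul_pow_mul, ← mul_assoc, pow_succ']

lemma mul_pow_le_pow_mul_pow {x y : H} (h : y * x ≤ x * y) (n : ℕ) :
    (x * y) ^ n ≤ x ^ n * y ^ n := by
  induction n with
  | zero => simp
  | succ n ih =>
    calc (x * y) ^ (n + 1) = x * (y * x) ^ n * y := by
          rw [mul_assoc, mul_pow_mul, ← mul_assoc, pow_succ']
      _ ≤ x * (x ^ n * y ^ n) * y := by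
          gcongr
          exact (pow_le_pow_left' h n).trans ih
      _ = x ^ (n + 1) * y ^ (n + 1) := by
          rw [pow_succ' x, pow_succ y]; group

lemma zpow_add_le_mul_pow {x y : H} {n : ℕ} {i j : ℤ}
    (hx : z ^ i ≤ x ^ n) (hy : z ^ j ≤ y ^ n) : z ^ (i + j) ≤ (x * y) ^ n := by
  rcases le_total (x * y) (y * x) with h | h
  · rw [zpow_add]
    exact (mul_le_mul' hx hy).trans (pow_mul_pow_le_mul_pow h n)
  · rw [add_comm, zpow_add]
    exact ((mul_le_mul' hy hx).trans (pow_mul_pow_le_mul_pow h n)).trans (pow_le_pow_left' h n)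

lemma zpow_add_lt_mul_pow {x y : H} {n : ℕ} {i j : ℤ}
    (hx : z ^ i < x ^ n) (hy : z ^ j < y ^ n) : z ^ (i + j) < (x * y) ^ n := by
  rcases le_total (x * y) (y * x) with h | h
  · rw [zpow_add]
    exact (mul_lt_mul_of_lt_of_lt hx hy).trans_le (pow_mul_pow_le_mul_pow h n)
  · rw [add_comm, zpow_add]
    exact ((mul_lt_mul_of_lt_of_lt hy hx).trans_le (pow_mul_pow_le_mul_pow h n)).trans_le
      (pow_le_pow_left' h n)

lemma mul_pow_le_zpow_add {x y : H} {n : ℕ} {i j : ℤ}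
    (hx : x ^ n ≤ z ^ i) (hy : y ^ n ≤ z ^ j) : (x * y) ^ n ≤ z ^ (i + j) := by
  rcases le_total (y * x) (x * y) with h | h
  · rw [zpow_add]
    exact (mul_pow_le_pow_mul_pow h n).trans (mul_le_mul' hx hy)
  · rw [add_comm, zpow_add]
    exact (pow_le_pow_left' h n).trans ((mul_pow_le_pow_mul_pow h n).trans (mul_le_mul' hy hx))

/-- The translation number of an element relative to a cofinal element `z > 1`. -/
lemma exists_translationNumber (hz : 1 < z) (h_floor : ∀ x, ∃ i : ℤ, z ^ i ≤ x ∧ x ≤ z ^ (i + 1)) :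
    ∃ ρ : H → ℝ, ∀ x (n : ℕ) (i : ℤ), 0 < n →
      (z ^ i ≤ x ^ n → i ≤ n * ρ x) ∧ (x ^ n ≤ z ^ i → n * ρ x ≤ i) := by
  let A (x : H) : Set ℝ := {q | ∃ (n : ℕ) (i : ℤ), 0 < n ∧ z ^ i ≤ x ^ n ∧ q = i / n}
  have hA {x : H} {m : ℕ} {j : ℤ} (hm : 0 < m) (hx : x ^ m ≤ z ^ j) :
      (j / m : ℝ) ∈ upperBounds (A x) := by
    rintro _ ⟨n, i, hn, h, rfl⟩
    rw [div_le_div_iff₀ (by positivity) (by positivity)]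
    have : z ^ (i * m) ≤ z ^ (j * n) := by
      rw [zpow_mul, zpow_mul, zpow_natCast, zpow_natCast]
      calc (z ^ i) ^ m ≤ (x ^ n) ^ m := pow_le_pow_left' h m
        _ = (x ^ m) ^ n := pow_right_comm x n m
        _ ≤ _ := pow_le_pow_left' hx n
    rw [zpow_le_zpow_iff_of_one_lt hz] at this
    exact_mod_cast this
  refine ⟨fun x ↦ sSup (A x), fun x n i hn ↦ ⟨fun h ↦ ?_, fun h ↦ ?_⟩⟩
  · obtain ⟨j, -, hj⟩ := h_floor x
    have : (i / n : ℝ) ≤ sSup (A x) :=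
      le_csSup ⟨_, hA one_pos ((pow_one x).trans_le hj)⟩ ⟨n, i, hn, h, rfl⟩
    rwa [div_le_iff₀' (by positivity)] at this
  · obtain ⟨j, hj, -⟩ := h_floor x
    have : sSup (A x) ≤ i / n :=
      csSup_le ⟨_, 1, j, one_pos, by rwa [pow_one], rfl⟩ (hA hn h)
    rwa [le_div_iff₀' (by positivity)] at this

/-- In a bi-ordered group, the translation number is additive. -/
lemma exists_additive_translationNumber (hz : 1 < z)
    (h_floor : ∀ x, ∃ i : ℤ, z ^ i ≤ x ∧ x ≤ z ^ (i + 1)) :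
    ∃ ρ : H → ℝ, (∀ x y, ρ (x * y) = ρ x + ρ y) ∧ ∀ i : ℤ, ρ (z ^ i) = i := by
  obtain ⟨ρ, hρ⟩ := exists_translationNumber hz h_floor
  refine ⟨ρ, fun x y ↦ ?_, fun i ↦ ?_⟩
  · have key (n : ℕ) (hn : 0 < n) : n * |ρ (x * y) - (ρ x + ρ y)| ≤ 2 := by
      obtain ⟨i, hi, hi'⟩ := h_floor (x ^ n)
      obtain ⟨j, hj, hj'⟩ := h_floor (y ^ n)
      have h₁ := (hρ x n i hn).1 hi
      have h₂ := (hρ x n _ hn).2 hi'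
      have h₃ := (hρ y n j hn).1 hj
      have h₄ := (hρ y n _ hn).2 hj'
      have h₅ := (hρ (x * y) n _ hn).1 (zpow_add_le_mul_pow hi hj)
      have h₆ := (hρ (x * y) n _ hn).2 (mul_pow_le_zpow_add hi' hj')
      push_cast at h₂ h₄ h₅ h₆
      rw [← Nat.abs_cast n, ← abs_mul, abs_le]
      constructor <;> linarith
    by_contra hne
    have hpos : 0 < |ρ (x * y) - (ρ x + ρ y)| := abs_pos.2 (sub_ne_zero.2 hne)
    obtain ⟨n, hn⟩ := exists_nat_gt (2 / |ρ (x * y) - (ρ x + ρ y)|)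
    rw [div_lt_iff₀ hpos] at hn
    exact absurd (key n (Nat.pos_of_ne_zero (by rintro rfl; norm_num at hn))) hn.not_ge
  · have := hρ (z ^ i) 1 i one_pos
    simp only [pow_one, le_refl, forall_const, Nat.cast_one, one_mul] at this
    exact le_antisymm this.2 this.1

end BiorderedGroups

open Classical in
/-- `ℝ ⧸ ℚ` is orderable, being a rational vector space. -/
lemma exists_positiveCone_real_mod_rat : ∃ S : ℝ → Prop, (∀ a b, S a → S b → S (a + b)) ∧
    (∀ a (q : ℚ), S a → S (a + q)) ∧ (∀ q : ℚ, ¬ S q) ∧ ∀ a, S a ∨ S (-a) ∨ ∃ q : ℚ, a = q := by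
  let V := ℝ ⧸ Submodule.span ℚ {(1 : ℝ)}
  let b := Module.Basis.ofVectorSpace ℚ V
  let _ : LinearOrder (Module.Basis.ofVectorSpaceIndex ℚ V) := linearOrderOfSTO WellOrderingRel
  let f : ℝ →+ Lex (Module.Basis.ofVectorSpaceIndex ℚ V →₀ ℚ) :=
    { toFun a := toLex (b.repr (Submodule.Quotient.mk a))
      map_zero' := by simp
      map_add' := by simp }
  have hf (a : ℝ) : f a = 0 ↔ ∃ q : ℚ, a = q := by
    change toLex (b.repr (Submodule.Quotient.mk a)) = 0 ↔ _
    rw [toLex_eq_zero, LinearEquiv.map_eq_zero_iff, Submodule.Quotient.mk_eq_zero,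
      Submodule.mem_span_singleton]
    simp [Rat.smul_def, eq_comm]
  refine ⟨fun a ↦ 0 < f a, fun a b ha hb ↦ ?_, fun a q ha ↦ ?_, fun q ↦ ?_, fun a ↦ ?_⟩ <;> beta_reduce
  · rw [map_add]
    exact add_pos ha hb
  · rwa [map_add, (hf q).2 ⟨q, rfl⟩, add_zero]
  · rw [(hf q).2 ⟨q, rfl⟩]
    exact lt_irrefl _
  · rw [← hf, map_neg, neg_pos]
    have := lt_trichotomy (f a) 0
    tauto

theorem leftOrderable_of_biordered_extension {H G : Type*} [Group H] [LinearOrder H]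
    [MulLeftMono H] [MulRightMono H] [Group G] {z : H} (hz : 1 < z)
    (h_floor : ∀ x, ∃ i : ℤ, z ^ i ≤ x ∧ x ≤ z ^ (i + 1)) (π : H →* G)
    (hπ : Function.Surjective π) (h_ker : ∀ x, π x = 1 ↔ ∃ i : ℤ, z ^ i = x)
    (h_tf : ∀ (g : G) (n : ℕ), 0 < n → g ^ n = 1 → g = 1) : LeftOrderable G := by
  obtain ⟨ρ, hρ_mul, hρ_z⟩ := exists_additive_translationNumber hz h_floor
  obtain ⟨S, hS_add, hS_rat, hS_not, hS_total⟩ := exists_positiveCone_real_mod_rat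
  have hρ_inv (x : H) : ρ x⁻¹ = -ρ x := by
    have h := hρ_mul x x⁻¹
    have h₀ := hρ_z 0
    rw [mul_inv_cancel] at h
    rw [zpow_zero] at h₀
    push_cast at h₀
    linarith
  let Q (x : H) : Prop := S (ρ x) ∨ ∃ (n : ℕ) (i : ℤ), 0 < n ∧ n * ρ x = i ∧ z ^ i < x ^ n
  have rat_of {r : ℝ} {n : ℕ} {i : ℤ} (hn : 0 < n) (h : n * r = i) : ∃ q : ℚ, r = q :=
    ⟨i / n, by push_cast; rw [eq_div_iff (by positivity), mul_comm, h]⟩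
  have hQ_mul (x y : H) (hx : Q x) (hy : Q y) : Q (x * y) := by
    simp only [Q, hρ_mul]
    rcases hx with hx | ⟨n, i, hn, hx, hxi⟩ <;> rcases hy with hy | ⟨m, j, hm, hy, hyj⟩
    · exact Or.inl (hS_add _ _ hx hy)
    · obtain ⟨q, hq⟩ := rat_of hm hy
      exact Or.inl (hq ▸ hS_rat _ q hx)
    · obtain ⟨q, hq⟩ := rat_of hn hx
      exact Or.inl (hq ▸ add_comm (ρ y) q ▸ hS_rat _ q hy)
    · refine Or.inr ⟨n * m, i * m + j * n, by positivity, ?_, zpow_add_lt_mul_pow ?_ ?_⟩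
      · push_cast
        linear_combination m * hx + n * hy
      · rw [zpow_mul, zpow_natCast, pow_mul]
        exact pow_lt_pow_left' hm.ne' hxi
      · rw [zpow_mul, zpow_natCast, mul_comm, pow_mul]
        exact pow_lt_pow_left' hn.ne' hyj
  refine leftOrderable_of_positiveCone (fun g ↦ ∃ x, π x = g ∧ Q x) ?_ ?_ fun g hg ↦ ?_
  · rintro ⟨x, hx, hQ⟩
    obtain ⟨i, rfl⟩ := (h_ker x).1 hx
    rcases hQ with hQ | ⟨n, j, hn, hj, hlt⟩
    · exact hS_not i (by simpa [hρ_z] using hQ)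
    · rw [hρ_z] at hj
      rw [← zpow_natCast, ← zpow_mul, zpow_lt_zpow_iff_of_one_lt hz] at hlt
      norm_cast at hj
      lia
  · rintro _ _ ⟨x, rfl, hx⟩ ⟨y, rfl, hy⟩
    exact ⟨x * y, map_mul π x y, hQ_mul x y hx hy⟩
  · obtain ⟨x, rfl⟩ := hπ g
    rcases hS_total (ρ x) with h | h | ⟨q, hq⟩
    · exact Or.inl ⟨x, rfl, Or.inl h⟩
    · exact Or.inr ⟨x⁻¹, map_inv π x, Or.inl (by rwa [hρ_inv])⟩
    · have hden : (q.den : ℝ) * ρ x = q.num := by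
        rw [hq]
        exact_mod_cast Rat.den_mul_eq_num q
      rcases lt_trichotomy (z ^ q.num) (x ^ q.den) with h | h | h
      · exact Or.inl ⟨x, rfl, Or.inr ⟨q.den, q.num, q.pos, hden, h⟩⟩
      · refine absurd (h_tf _ q.den q.pos ?_) hg
        rw [← map_pow]
        exact (h_ker _).2 ⟨_, h⟩
      · refine Or.inr ⟨x⁻¹, map_inv π x, Or.inr ⟨q.den, -q.num, q.pos, ?_, ?_⟩⟩
        · rw [hρ_inv]
          push_cast
          linarith
        · rw [zpow_neg, inv_pow]
          exact inv_lt_inv_iff.2 h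

section CircularLift

variable {G : Type*} {c : G → G → G → ℤ}

open Classical in
/-- Whether the positive arc from `x` to `y` passes through the base point `p` (or ends there). -/
noncomputable def wrap (c : G → G → G → ℤ) (p x y : G) : ℤ :=
  if (y = p ∧ x ≠ p) ∨ c p y x = 1 then 1 else 0

lemma wrap_congr {p x y q u v : G}
    (h : (y = p ∧ x ≠ p) ∨ c p y x = 1 ↔ (v = q ∧ u ≠ q) ∨ c q v u = 1) :
    wrap c p x y = wrap c q u v := by
  unfold wrap
  split_ifs <;> first | rfl | tauto

lemma wrap_nonneg (p x y : G) : 0 ≤ wrap c p x y := by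
  unfold wrap; split_ifs <;> simp

lemma wrap_le_one (p x y : G) : wrap c p x y ≤ 1 := by
  unfold wrap; split_ifs <;> simp

lemma wrap_self_right {p x : G} (h : x ≠ p) : wrap c p x p = 1 := by
  simp [wrap, h]

variable [Group G]

namespace IsHomCircularOrdering

lemma wrap_mul_left (hc : IsHomCircularOrdering c) (h p x y : G) :
    wrap c (h * p) (h * x) (h * y) = wrap c p x y :=
  wrap_congr (by simp only [hc.2.2.2, mul_right_inj, ne_eq])

lemma wrap_self_left (hc : IsHomCircularOrdering c) (p x : G) : wrap c p p x = 0 := by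
  simp [wrap, (hc.2.1 p x p).2]

lemma wrap_self (hc : IsHomCircularOrdering c) (p x : G) : wrap c p x x = 0 := by
  simp [wrap, (hc.2.1 p x x).2]

open Classical in
lemma two_mul_wrap (hc : IsHomCircularOrdering c) (p x y : G) :
    2 * wrap c p x y = 1 - c p x y - (if x = p then 1 else 0) + (if y = p then 1 else 0)
      - (if x = y then 1 else 0) := by
  have := hc.1 p x y
  have := hc.2.1 p x y
  have := hc.swap p x y
  have := hc.rotate x p y
  grind [wrap]

lemma wrap_cocycle (hc : IsHomCircularOrdering c) (p a x y : G) :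
    wrap c p a x + wrap c p x y = wrap c a x y + wrap c p a y := by
  have := hc.two_mul_wrap p a x
  have := hc.two_mul_wrap p x y
  have := hc.two_mul_wrap a x y
  have := hc.two_mul_wrap p a y
  have := hc.2.2.1 p a x y
  grind

end IsHomCircularOrdering

namespace IsBiInvariantCircularOrdering

lemma conj (hc : IsBiInvariantCircularOrdering c) (x a b : G) :
    c 1 (x⁻¹ * a * x) (x⁻¹ * b * x) = c 1 a b := by
  rw [← hc.1.2.2.2 x⁻¹ 1 a b, ← hc.2 x (x⁻¹ * 1), mul_one, inv_mul_cancel]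

lemma inv (hc : IsBiInvariantCircularOrdering c) {x y : G} (h : c 1 x y = 1) :
    c 1 y⁻¹ x⁻¹ = 1 := by
  have hne : c 1 x y ≠ 0 := by lia
  rw [ne_eq, hc.1.2.1, not_or, not_or] at hne
  obtain ⟨hx, hy, hxy⟩ := hne
  have h_swap : c 1 y⁻¹ x⁻¹ = -c 1 x⁻¹ y⁻¹ := by
    rw [← hc.1.rotate, hc.1.swap, hc.1.rotate]
  rcases hc.1.eq_one_or_eq_neg_one (a := 1) (b := y⁻¹) (d := x⁻¹) (by simpa [eq_comm] using hy)
    (by simpa [eq_comm] using hx) (by simpa [eq_comm] using hxy) with h₁ | h₁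
  · exact h₁
  exfalso
  have h' : c 1 x⁻¹ y⁻¹ = 1 := by lia
  have move_first {a b : G} (hab : c 1 a b = 1) : c 1 (a⁻¹ * b) a⁻¹ = 1 := by
    rw [← hc.1.2.2.2 a⁻¹ 1 a b, mul_one, inv_mul_cancel] at hab
    rwa [hc.1.rotate a⁻¹]
  have move_second {a b : G} (hab : c 1 a b = 1) : c 1 b⁻¹ (b⁻¹ * a) = 1 := by
    rw [← hc.1.2.2.2 b⁻¹ 1 a b, mul_one, inv_mul_cancel] at hab
    rwa [← hc.1.rotate, ← hc.1.rotate] at hab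
  have hx_lt : c 1 x x⁻¹ = 1 := by
    have h₂ := hc.1.trans h (by simpa using move_second h')
    rw [← hc.conj x] at h₂
    exact hc.1.trans (by simpa [mul_assoc] using h₂) (move_first h)
  have hlt_x : c 1 x⁻¹ x = 1 := by
    have h₂ : c 1 (x * y⁻¹) x = 1 := by simpa using move_first h'
    rw [← hc.conj x] at h₂
    exact hc.1.trans h' (hc.1.trans (move_second h) (by simpa [mul_assoc] using h₂))
  have := hc.1.trans hx_lt hlt_x
  have := (hc.1.2.1 1 x x).2 (by simp)
  lia

lemma wrap_conj (hc : IsBiInvariantCircularOrdering c) (h g : G) :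
    wrap c 1 (h * g * h⁻¹) (h * g) = wrap c 1 h (h * g) := by
  generalize h * g = w
  have h₁ : c 1 w (w * h⁻¹) = c 1 h⁻¹ w⁻¹ := by
    rw [← hc.1.2.2.2 w⁻¹ 1 w, mul_one, inv_mul_cancel, inv_mul_cancel_left, hc.1.rotate w⁻¹]
  have h₂ : c 1 w h = 1 ↔ c 1 h⁻¹ w⁻¹ = 1 := ⟨hc.inv, fun h ↦ by simpa using hc.inv h⟩
  refine wrap_congr ?_
  rw [h₁, h₂]
  by_cases hw : w = 1 <;> simp [hw]

end IsBiInvariantCircularOrdering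

/-- The central extension of `G` by `ℤ` whose cocycle counts the turns made by a product in the
circular order: the element `⟨n, g⟩` is the lift of `g` in the `n`-th turn. -/
@[ext]
structure CircularLift (hc : IsHomCircularOrdering c) where
  turn : ℤ
  base : G

namespace CircularLift

section Group

variable {hc : IsHomCircularOrdering c}

instance : One (CircularLift hc) := ⟨⟨0, 1⟩⟩

noncomputable instance : Mul (CircularLift hc) :=
  ⟨fun x y ↦ ⟨x.turn + y.turn + wrap c 1 x.base (x.base * y.base), x.base * y.base⟩⟩

noncomputable instance : Inv (CircularLift hc) :=
  ⟨fun x ↦ ⟨-x.turn - wrap c 1 x.base⁻¹ 1, x.base⁻¹⟩⟩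

@[simp] lemma turn_one : (1 : CircularLift hc).turn = 0 := rfl

@[simp] lemma base_one : (1 : CircularLift hc).base = 1 := rfl

lemma turn_mul (x y : CircularLift hc) :
    (x * y).turn = x.turn + y.turn + wrap c 1 x.base (x.base * y.base) := rfl

@[simp] lemma base_mul (x y : CircularLift hc) : (x * y).base = x.base * y.base := rfl

lemma turn_inv (x : CircularLift hc) : x⁻¹.turn = -x.turn - wrap c 1 x.base⁻¹ 1 := rfl

@[simp] lemma base_inv (x : CircularLift hc) : x⁻¹.base = x.base⁻¹ := rfl

noncomputable instance : Group (CircularLift hc) :=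
  Group.ofLeftAxioms
    (fun x y w ↦ by
      ext
      · have h₁ := hc.wrap_cocycle 1 x.base (x.base * y.base) (x.base * y.base * w.base)
        have h₂ := hc.wrap_mul_left x.base 1 y.base (y.base * w.base)
        rw [mul_one, ← mul_assoc] at h₂
        simp only [turn_mul, base_mul, ← mul_assoc]
        lia
      · simp [mul_assoc])
    (fun x ↦ by ext <;> simp [turn_mul, hc.wrap_self_left])
    (fun x ↦ by
      ext
      · rw [turn_mul, turn_inv, base_inv, inv_mul_cancel, turn_one]
        lia
      · simp)

/-- The lifts of the identity of `G`. -/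
noncomputable def fiber (hc : IsHomCircularOrdering c) : Multiplicative ℤ →* CircularLift hc where
  toFun n := ⟨n.toAdd, 1⟩
  map_one' := rfl
  map_mul' m n := by ext <;> simp [turn_mul, hc.wrap_self_left]

lemma mk_one_one_zpow (i : ℤ) : (⟨1, 1⟩ : CircularLift hc) ^ i = ⟨i, 1⟩ := by
  have := map_zpow (fiber hc) (Multiplicative.ofAdd 1) i
  rw [← ofAdd_zsmul, smul_eq_mul, mul_one] at this
  exact this.symm

/-- The projection onto `G`. -/
noncomputable def proj (hc : IsHomCircularOrdering c) : CircularLift hc →* G where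
  toFun := base
  map_one' := rfl
  map_mul' _ _ := rfl

lemma turn_mul_nonneg {x y : CircularLift hc} (hx : 0 ≤ x.turn) (hy : 0 ≤ y.turn) :
    0 ≤ (x * y).turn := by
  have := wrap_nonneg (c := c) 1 x.base (x.base * y.base)
  rw [turn_mul]
  lia

lemma eq_one_of_turn_nonneg {x : CircularLift hc} (hx : 0 ≤ x.turn) (hx' : 0 ≤ x⁻¹.turn) :
    x = 1 := by
  rw [turn_inv] at hx'
  by_cases h : x.base = 1
  · rw [h, inv_one, hc.wrap_self_left] at hx'
    exact CircularLift.ext (by rw [turn_one]; lia) h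
  · rw [wrap_self_right (inv_ne_one.2 h)] at hx'
    lia

lemma turn_nonneg_or (x : CircularLift hc) : 0 ≤ x.turn ∨ 0 ≤ x⁻¹.turn := by
  have := wrap_le_one (c := c) 1 x.base⁻¹ 1
  rw [turn_inv]
  lia

open Classical in
noncomputable instance : LinearOrder (CircularLift hc) where
  le x y := 0 ≤ (x⁻¹ * y).turn
  le_refl x := by simp
  le_trans x y w h₁ h₂ := by simpa [mul_assoc] using turn_mul_nonneg h₁ h₂
  le_antisymm x y h₁ h₂ := by
    rw [← inv_mul_eq_one]
    exact eq_one_of_turn_nonneg h₁ (by rwa [mul_inv_rev, inv_inv])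
  le_total x y := by simpa using turn_nonneg_or (x⁻¹ * y)
  toDecidableLE := inferInstance

lemma le_iff {x y : CircularLift hc} : x ≤ y ↔ 0 ≤ (x⁻¹ * y).turn := Iff.rfl

instance : MulLeftMono (CircularLift hc) :=
  ⟨fun x y w h ↦ by
    rw [le_iff] at h ⊢
    simpa [mul_assoc] using h⟩

end Group

lemma turn_conj {hc : IsHomCircularOrdering c} (hc' : IsBiInvariantCircularOrdering c)
    (h x : CircularLift hc) : (h * x * h⁻¹).turn = x.turn := by
  have h₁ := turn_mul (h * x * h⁻¹) h
  have h₂ := hc'.wrap_conj h.base x.base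
  simp only [inv_mul_cancel_right, base_mul, base_inv, turn_mul h x] at h₁
  lia

lemma mulRightMono {hc : IsHomCircularOrdering c} (hc' : IsBiInvariantCircularOrdering c) :
    MulRightMono (CircularLift hc) :=
  ⟨fun x y w h ↦ by
    rw [le_iff] at h ⊢
    rw [← turn_conj hc' x⁻¹] at h
    simpa [mul_assoc, Function.swap] using h⟩

end CircularLift

end CircularLift

theorem IsBiInvariantCircularOrdering.leftOrderable {G : Type*} [Group G] {c : G → G → G → ℤ}
    (hc : IsBiInvariantCircularOrdering c)
    (h_tf : ∀ (g : G) (n : ℕ), 0 < n → g ^ n = 1 → g = 1) : LeftOrderable G := by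
  have := CircularLift.mulRightMono (hc := hc.1) hc
  refine leftOrderable_of_biordered_extension (z := (⟨1, 1⟩ : CircularLift hc.1)) ?_
    (fun x ↦ ⟨x.turn, ?_, ?_⟩) (CircularLift.proj hc.1) (fun g ↦ ⟨⟨0, g⟩, rfl⟩) (fun x ↦ ?_) h_tf
  · refine lt_of_le_of_ne ?_ (by simp [CircularLift.ext_iff])
    simp [CircularLift.le_iff]
  · rw [← mul_one (_ ^ _), ← le_inv_mul_iff_mul_le, CircularLift.le_iff, ← zpow_neg,
      CircularLift.mk_one_one_zpow]
    simp [CircularLift.turn_mul, hc.1.wrap_self_left]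
  · rw [CircularLift.le_iff, CircularLift.mk_one_one_zpow, CircularLift.turn_mul,
      CircularLift.turn_inv, CircularLift.base_inv, mul_one, hc.1.wrap_self]
    have := wrap_le_one (c := c) 1 x.base⁻¹ 1
    lia
  · simp_rw [CircularLift.mk_one_one_zpow, CircularLift.ext_iff]
    exact ⟨fun h ↦ ⟨x.turn, rfl, h.symm⟩, fun ⟨_, _, h⟩ ↦ h.symm⟩

/-- If `G` admits a bi-invariant circular ordering, then `G × G` is circularly-orderable
if and only if `G` is left-orderable. -/
theorem square_circularlyOrderable_iff_leftOrderable {G : Type*} [Group G]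
    (hG : ∃ c : G → G → G → ℤ, IsBiInvariantCircularOrdering c) :
    CircularlyOrderable (G × G) ↔ LeftOrderable G := by
  obtain ⟨c, hc⟩ := hG
  exact ⟨fun h ↦ hc.leftOrderable fun _ _ ↦ eq_one_of_pow_eq_one_of_circularlyOrderable_prod h,
    fun h ↦ (h.prod h).circularlyOrderable⟩
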